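/- arXiv:1009.3751 — 11 statements merged into one kernel-verified Lean document; each statement's English description precedes it below -/
import Mathlib

section
/- Let q be a probability mass function on a finite alphabet of m symbols with all entries strictly positive. Then there exists a dyadic PMF p on the same alphabet such that the Kullback-Leibler distance satisfies D(p‖q) = Σ_i p_i·log(p_i/q_i) ≤ log 2. -/
/-- A probability mass function on a finite alphabet: nonnegative entries summing to 1. -/
def IsPMF {α : Type*} [Fintype α] (p : α → ℝ) : Prop :=
  (∀ i, 0 ≤ p i) ∧ ∑ i, p i = 1

/-- A PMF is dyadic if every entry is 0 or of the form 2^(-ℓ) for a natural number ℓ. -/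
def IsDyadic {α : Type*} [Fintype α] (p : α → ℝ) : Prop :=
  ∀ i, p i = 0 ∨ ∃ ℓ : ℕ, p i = (2 : ℝ) ^ (-(ℓ : ℤ))

/-- Kullback-Leibler distance D(p‖x) = Σ_i p_i log(p_i / x_i) (natural log),
with the convention 0·log 0 = 0 (automatic since `Real.log 0 = 0`). -/
noncomputable def KL {α : Type*} [Fintype α] (p x : α → ℝ) : ℝ :=
  ∑ i, p i * Real.log (p i / x i)

/-- A finite family of powers of `1/2` with total mass at least `1` has a subfamily of total
mass exactly `1`. -/
theorem exists_subset_sum_half_pow_eq_one {ι : Type*} [DecidableEq ι] (l : ι → ℕ)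
    (s : Finset ι) (hs : 1 ≤ ∑ i ∈ s, (1 / 2 : ℝ) ^ l i) :
    ∃ t ⊆ s, ∑ i ∈ t, (1 / 2 : ℝ) ^ l i = 1 := by
  induction s using Finset.strongInduction with
  | H s ih =>
    by_cases h : ∃ i ∈ s, 1 ≤ ∑ j ∈ s.erase i, (1 / 2 : ℝ) ^ l j
    · obtain ⟨i, hi, hsum⟩ := h
      obtain ⟨t, ht, ht1⟩ := ih _ (Finset.erase_ssubset hi) hsum
      exact ⟨t, ht.trans (Finset.erase_subset i s), ht1⟩
    · push Not at h
      have hne : s.Nonempty := by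
        rw [Finset.nonempty_iff_ne_empty]
        rintro rfl
        norm_num at hs
      obtain ⟨i, hi, hmax⟩ := s.exists_max_image l hne
      refine ⟨s, subset_rfl, le_antisymm ?_ hs⟩
      have hlt := h i hi
      have hpos : (0 : ℝ) < 2 ^ l i := by positivity
      have hscale : (2 : ℝ) ^ l i * ∑ j ∈ s.erase i, (1 / 2 : ℝ) ^ l j
          = ((∑ j ∈ s.erase i, 2 ^ (l i - l j) : ℕ) : ℝ) := by
        push_cast
        rw [Finset.mul_sum]
        refine Finset.sum_congr rfl fun j hj => ?_
        rw [pow_sub₀ _ two_ne_zero (hmax j (Finset.mem_of_mem_erase hj)), one_div, inv_pow]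
      have hnat : ∑ j ∈ s.erase i, 2 ^ (l i - l j) < 2 ^ l i := by
        have := mul_lt_mul_of_pos_left hlt hpos
        rw [hscale, mul_one] at this
        exact_mod_cast this
      have hle : (2 : ℝ) ^ l i * ∑ j ∈ s.erase i, (1 / 2 : ℝ) ^ l j + 1 ≤ 2 ^ l i := by
        rw [hscale]
        exact_mod_cast hnat
      have hone : (2 : ℝ) ^ l i * (1 / 2) ^ l i = 1 := by
        rw [← mul_pow]; norm_num
      rw [← Finset.add_sum_erase s _ hi]
      refine le_of_mul_le_mul_left ?_ hpos
      rw [mul_add, hone]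
      linarith

/-- If `p ≤ c • q` entrywise for a PMF `p` and a positive vector `q`, then `D(p‖q) ≤ log c`. -/
theorem KL_le_log_of_le_mul {α : Type*} [Fintype α] {p q : α → ℝ} {c : ℝ} (hp : IsPMF p)
    (hq : ∀ i, 0 < q i) (h : ∀ i, p i ≤ c * q i) : KL p q ≤ Real.log c := by
  calc KL p q ≤ ∑ i, p i * Real.log c := by
        refine Finset.sum_le_sum fun i _ => ?_
        rcases (hp.1 i).eq_or_lt with h0 | h0
        · simp [← h0]
        · exact mul_le_mul_of_nonneg_left
            (Real.log_le_log (div_pos h0 (hq i)) ((div_le_iff₀ (hq i)).2 (h i))) h0.le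
    _ = Real.log c := by rw [← Finset.sum_mul, hp.2, one_mul]

/-- For every strictly positive PMF `q` on `m` symbols there is a dyadic PMF `p`
with `D(p‖q) ≤ log 2`. -/
theorem exists_dyadic_KL_le_log_two (m : ℕ) (q : Fin m → ℝ)
    (hq : IsPMF q) (hpos : ∀ i, 0 < q i) :
    ∃ p : Fin m → ℝ, IsPMF p ∧ IsDyadic p ∧ KL p q ≤ Real.log 2 := by
  have hle_one (i : Fin m) : q i ≤ 1 :=
    hq.2 ▸ Finset.single_le_sum (fun j _ => hq.1 j) (Finset.mem_univ i)
  have hex (i : Fin m) : ∃ n : ℕ, (1 / 2 : ℝ) ^ (n + 1) < q i ∧ q i ≤ (1 / 2) ^ n :=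
    exists_nat_pow_near_of_lt_one (hpos i) (hle_one i) (by norm_num) (by norm_num)
  choose l hlow hupp using hex
  obtain ⟨t, -, ht⟩ := exists_subset_sum_half_pow_eq_one l Finset.univ
    (hq.2.symm.le.trans (Finset.sum_le_sum fun i _ => hupp i))
  have hpmf : IsPMF fun i => if i ∈ t then (1 / 2 : ℝ) ^ l i else 0 := by
    refine ⟨fun i => ?_, by simpa using ht⟩
    dsimp only
    split_ifs <;> positivity
  refine ⟨_, hpmf, fun i => ?_, KL_le_log_of_le_mul hpmf hpos fun i => ?_⟩
  · by_cases hi : i ∈ t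
    · exact Or.inr ⟨l i, by simp [hi]⟩
    · exact Or.inl (by simp [hi])
  · have hl := hlow i
    have hp := hpos i
    rw [pow_succ] at hl
    split_ifs <;> linarith
end

section
/- Let q be a PMF on m symbols with q_1 ≥ q_2 ≥ ⋯ ≥ q_m > 0, and for each i set p_i = 2^{-⌊-log₂ q_i⌋}. Then there exists an index k with 1 ≤ k ≤ m such that Σ_{i=1}^{k} p_i = 1 (so that setting the first k entries to these values and the remaining entries to 0 yields a dyadic PMF). -/
/-- If negative powers of two with nondecreasing exponents sum to at least `1`, then some
partial sum is exactly `1`. -/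
theorem exists_sum_range_inv_two_pow_eq_one (a : ℕ → ℕ) (m : ℕ)
    (ha : ∀ i j, i ≤ j → j < m → a i ≤ a j)
    (hs : 1 ≤ ∑ i ∈ Finset.range m, ((2 : ℝ) ^ a i)⁻¹) :
    ∃ k ≤ m, ∑ i ∈ Finset.range k, ((2 : ℝ) ^ a i)⁻¹ = 1 := by
  induction m with
  | zero => norm_num at hs
  | succ n ih =>
    by_cases hn : 1 ≤ ∑ i ∈ Finset.range n, ((2 : ℝ) ^ a i)⁻¹
    · obtain ⟨k, hk, hk1⟩ := ih (fun i j hij hj => ha i j hij (by omega)) hn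
      exact ⟨k, by omega, hk1⟩
    · refine ⟨n + 1, le_rfl, le_antisymm ?_ hs⟩
      have hpos : (0 : ℝ) < 2 ^ a n := by positivity
      have hint : (∑ i ∈ Finset.range n, ((2 : ℝ) ^ a i)⁻¹) * 2 ^ a n =
          ((∑ i ∈ Finset.range n, 2 ^ (a n - a i) : ℕ) : ℝ) := by
        push_cast
        rw [Finset.sum_mul]
        refine Finset.sum_congr rfl fun i hi => ?_
        rw [pow_sub₀ _ two_ne_zero (ha i n (Finset.mem_range.mp hi).le n.lt_succ_self), mul_comm]
      have hlt := mul_lt_mul_of_pos_right (not_le.mp hn) hpos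
      rw [hint, one_mul] at hlt
      have hle : (∑ i ∈ Finset.range n, 2 ^ (a n - a i)) + 1 ≤ 2 ^ a n := by
        exact_mod_cast hlt
      have hle' : ((∑ i ∈ Finset.range n, 2 ^ (a n - a i) : ℕ) : ℝ) + 1 ≤ 2 ^ a n := by
        exact_mod_cast hle
      refine le_of_mul_le_mul_right ?_ hpos
      rwa [Finset.sum_range_succ, add_mul, hint, inv_mul_cancel₀ hpos.ne', one_mul]

/-- Summing over the elements of `Fin m` below `k ≤ m` is summing over `Finset.range k`. -/
theorem Fin.sum_filter_val_lt {M : Type*} [AddCommMonoid M] {k m : ℕ} (hk : k ≤ m) (f : ℕ → M) :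
    ∑ i ∈ Finset.univ.filter (fun i : Fin m => (i : ℕ) < k), f i =
      ∑ i ∈ Finset.range k, f i := by
  rw [Finset.sum_filter, Fin.sum_univ_eq_sum_range (fun i => if i < k then f i else 0),
    ← Finset.sum_filter]
  refine Finset.sum_congr (Finset.ext fun i => ?_) fun _ _ => rfl
  simp only [Finset.mem_filter, Finset.mem_range]
  omega

/-- Greedy Channel Coding: for a PMF `q` with `q_1 ≥ q_2 ≥ ⋯ ≥ q_m > 0` and
`p_i = 2^(-⌊-log₂ q_i⌋)`, there is an index `k` with `1 ≤ k ≤ m` such that the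
first `k` entries of `p` sum to 1 (so keeping them and zeroing the rest gives
a dyadic PMF). -/
theorem gcc_well_defined (m : ℕ) (q : Fin m → ℝ) (hq : IsPMF q)
    (hpos : ∀ i, 0 < q i) (hmono : ∀ i j : Fin m, i ≤ j → q j ≤ q i)
    (p : Fin m → ℝ) (hp : ∀ i, p i = (2 : ℝ) ^ (-⌊-Real.logb 2 (q i)⌋)) :
    ∃ k : ℕ, 1 ≤ k ∧ k ≤ m ∧
      ∑ i ∈ Finset.univ.filter (fun i : Fin m => (i : ℕ) < k), p i = 1 := by
  have hq1 : ∀ i, q i ≤ 1 := fun i =>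
    hq.2 ▸ Finset.single_le_sum (fun j _ => hq.1 j) (Finset.mem_univ i)
  have hfloor : ∀ i, 0 ≤ ⌊-Real.logb 2 (q i)⌋ := fun i =>
    Int.floor_nonneg.mpr (neg_nonneg.mpr
      (Real.logb_nonpos one_lt_two (hpos i).le (hq1 i)))
  have hqp : ∀ i, q i ≤ p i := fun i => by
    rw [hp, ← Real.rpow_intCast, ← Real.logb_le_iff_le_rpow one_lt_two (hpos i)]
    push_cast
    linarith [Int.floor_le (-Real.logb 2 (q i))]
  let a : ℕ → ℕ := fun n => if h : n < m then ⌊-Real.logb 2 (q ⟨n, h⟩)⌋.toNat else 0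
  have hpa : ∀ i : Fin m, p i = ((2 : ℝ) ^ a i)⁻¹ := fun i => by
    have hai : ((a i : ℕ) : ℤ) = ⌊-Real.logb 2 (q i)⌋ := by
      simp [a, hfloor i]
    rw [hp, ← hai, zpow_neg, zpow_natCast]
  have hamono : ∀ i j, i ≤ j → j < m → a i ≤ a j := fun i j hij hj => by
    simp only [a, hj, hij.trans_lt hj, dif_pos]
    exact Int.toNat_le_toNat (Int.floor_le_floor (neg_le_neg
      (Real.logb_le_logb_of_le one_lt_two (hpos _) (hmono ⟨i, _⟩ ⟨j, hj⟩ hij))))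
  have hsum : 1 ≤ ∑ i ∈ Finset.range m, ((2 : ℝ) ^ a i)⁻¹ := by
    rw [← Fin.sum_univ_eq_sum_range (fun i => ((2 : ℝ) ^ a i)⁻¹), ← hq.2]
    exact Finset.sum_le_sum fun i _ => hpa i ▸ hqp i
  obtain ⟨k, hkm, hk⟩ := exists_sum_range_inv_two_pow_eq_one a m hamono hsum
  refine ⟨k, Nat.one_le_iff_ne_zero.mpr ?_, hkm, ?_⟩
  · rintro rfl
    simp at hk
  · rw [← hk, ← Fin.sum_filter_val_lt hkm (fun i => ((2 : ℝ) ^ a i)⁻¹)]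
    exact Finset.sum_congr rfl fun i _ => hpa i
end

section
/- Let (h_{ji}), 1 ≤ j ≤ n, 1 ≤ i ≤ m, be a discrete memoryless channel (each column is a PMF on the n outputs). Let p* be a PMF on the m inputs with output PMF r*_j = Σ_i h_{ji} p*_i, and let C be a real number such that Σ_j h_{ji}·log(h_{ji}/r*_j) = C for every i with p*_i > 0. Then for every input PMF p satisfying p_i = 0 whenever p*_i = 0, with output PMF r_j = Σ_i h_{ji} p_i, the mutual information satisfies I(p) = C − D(r‖r*), where I(p) = Σ_i p_i Σ_j h_{ji}·log(h_{ji}/r_j). -/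
/-- For a DMC `(h j i)` (columns are PMFs on the outputs), a PMF `p*` with output
PMF `r*` and a constant `C` with `Σ_j h_{ji} log(h_{ji}/r*_j) = C` whenever `p*_i > 0`:
every input PMF `p` vanishing where `p*` vanishes satisfies
`I(p) = C − D(r‖r*)`, where `r` is the output PMF of `p`. -/
theorem mutual_information_eq_capacity_sub_KL (m n : ℕ) (h : Fin n → Fin m → ℝ)
    (hnn : ∀ j i, 0 ≤ h j i) (hcol : ∀ i, ∑ j, h j i = 1)
    (pstar : Fin m → ℝ) (hpstar : IsPMF pstar)
    (C : ℝ)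
    (hC : ∀ i, 0 < pstar i →
      ∑ j, h j i * Real.log (h j i / ∑ i', h j i' * pstar i') = C)
    (p : Fin m → ℝ) (hp : IsPMF p) (hzero : ∀ i, pstar i = 0 → p i = 0) :
    ∑ i, p i * ∑ j, h j i * Real.log (h j i / ∑ i', h j i' * p i') =
      C - ∑ j, (∑ i', h j i' * p i') *
        Real.log ((∑ i', h j i' * p i') / ∑ i', h j i' * pstar i') := by
  obtain ⟨hp0, hp1⟩ := hp
  have output_pos {q : Fin m → ℝ} (hq : ∀ i, 0 ≤ q i) {j : Fin n} {i : Fin m}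
      (hji : 0 < h j i) (hqi : 0 < q i) : 0 < ∑ i', h j i' * q i' :=
    Finset.sum_pos' (fun i' _ => mul_nonneg (hnn j i') (hq i'))
      ⟨i, Finset.mem_univ i, mul_pos hji hqi⟩
  have log_split (i : Fin m) (j : Fin n) :
      p i * (h j i * Real.log (h j i / ∑ i', h j i' * p i')) =
        p i * (h j i * Real.log (h j i / ∑ i', h j i' * pstar i')) -
          h j i * p i *
            Real.log ((∑ i', h j i' * p i') / ∑ i', h j i' * pstar i') := by
    rcases (hp0 i).eq_or_lt with hi | hi
    · simp [← hi]
    rcases (hnn j i).eq_or_lt with hji | hji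
    · simp [← hji]
    have hsi : 0 < pstar i := (hpstar.1 i).lt_of_ne' fun h0 => hi.ne' (hzero i h0)
    have hr := output_pos hp0 hji hi
    have hrs := output_pos hpstar.1 hji hsi
    rw [Real.log_div hji.ne' hr.ne', Real.log_div hji.ne' hrs.ne',
      Real.log_div hr.ne' hrs.ne']
    ring
  have sum_eq_C : ∑ i, p i * ∑ j, h j i * Real.log (h j i / ∑ i', h j i' * pstar i') = C := by
    have weighted (i : Fin m) :
        p i * ∑ j, h j i * Real.log (h j i / ∑ i', h j i' * pstar i') = p i * C := by
      rcases (hpstar.1 i).eq_or_lt with hi | hi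
      · simp [hzero i hi.symm]
      · rw [hC i hi]
    rw [Finset.sum_congr rfl fun i _ => weighted i, ← Finset.sum_mul, hp1, one_mul]
  rw [← sum_eq_C]
  simp_rw [Finset.mul_sum, log_split, Finset.sum_sub_distrib]
  congr 1
  rw [Finset.sum_comm]
  exact Finset.sum_congr rfl fun j _ => (Finset.sum_mul _ _ _).symm
end

section
/- Let (h_{ji}) be a discrete memoryless channel, let p* be an input PMF with output PMF r*, and let C be a real number such that Σ_j h_{ji}·log(h_{ji}/r*_j) = C for every i with p*_i > 0. Then for every input PMF p satisfying p_i = 0 whenever p*_i = 0, the mutual information satisfies I(p) ≥ C − D(p‖p*). -/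
/-- The termwise bound `w (log (h/r) - log (h/s) + log (a/b)) ≥ a h - h b r / s` with `w = a h`,
which follows from `log x ≥ 1 - 1/x`. -/
lemma mul_log_ratio_ge {a b h r s : ℝ} (ha : 0 ≤ a) (hb : 0 ≤ b) (hh : 0 ≤ h)
    (hr : 0 ≤ r) (hs : 0 ≤ s)
    (hpos : 0 < a → 0 < h → 0 < b ∧ 0 < r ∧ 0 < s) :
    a * h - h * b * (r / s) ≤
      a * h * (Real.log (h / r) - Real.log (h / s) + Real.log (a / b)) := by
  rcases ha.eq_or_lt with rfl | ha
  · have : 0 ≤ h * b * (r / s) := by positivity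
    simpa using this
  rcases hh.eq_or_lt with rfl | hh
  · simp
  obtain ⟨hb, hr, hs⟩ := hpos ha hh
  have hlog : Real.log (h / r) - Real.log (h / s) + Real.log (a / b) =
      -Real.log (b * r / (a * s)) := by
    rw [Real.log_div hh.ne' hr.ne', Real.log_div hh.ne' hs.ne', Real.log_div ha.ne' hb.ne',
      Real.log_div (by positivity) (by positivity), Real.log_mul hb.ne' hr.ne',
      Real.log_mul ha.ne' hs.ne']
    ring
  have hle := Real.log_le_sub_one_of_pos (x := b * r / (a * s)) (by positivity)
  calc a * h - h * b * (r / s) = a * h * (1 - b * r / (a * s)) := by field_simp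
    _ ≤ _ := by
      rw [hlog]
      exact mul_le_mul_of_nonneg_left (by linarith) (by positivity)

/-- The sum of a nonnegative `y` over the support of `x` is at most its total sum. -/
lemma sum_mul_div_le_sum {α : Type*} [Fintype α] {x y : α → ℝ} (hy : ∀ j, 0 ≤ y j) :
    ∑ j, x j * (y j / x j) ≤ ∑ j, y j := by
  refine Finset.sum_le_sum fun j _ => ?_
  rcases eq_or_ne (x j) 0 with hx | hx
  · simpa [hx] using hy j
  · rw [mul_div_cancel₀ _ hx]

/-- For a DMC `(h j i)`, a PMF `p*` with output PMF `r*` and constant `C` with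
`Σ_j h_{ji} log(h_{ji}/r*_j) = C` whenever `p*_i > 0`: every input PMF `p`
vanishing where `p*` vanishes satisfies `I(p) ≥ C − D(p‖p*)`. -/
theorem mutual_information_ge_capacity_sub_KL (m n : ℕ) (h : Fin n → Fin m → ℝ)
    (hnn : ∀ j i, 0 ≤ h j i) (hcol : ∀ i, ∑ j, h j i = 1)
    (pstar : Fin m → ℝ) (hpstar : IsPMF pstar)
    (C : ℝ)
    (hC : ∀ i, 0 < pstar i →
      ∑ j, h j i * Real.log (h j i / ∑ i', h j i' * pstar i') = C)
    (p : Fin m → ℝ) (hp : IsPMF p) (hzero : ∀ i, pstar i = 0 → p i = 0) :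
    ∑ i, p i * ∑ j, h j i * Real.log (h j i / ∑ i', h j i' * p i') ≥
      C - KL p pstar := by
  have hout : ∀ q : Fin m → ℝ, ∑ j, ∑ i, h j i * q i = ∑ i, q i := fun q => by
    rw [Finset.sum_comm]
    simp [← Finset.sum_mul, hcol]
  have hr : ∀ j, 0 ≤ ∑ i, h j i * p i := fun j =>
    Finset.sum_nonneg fun i _ => mul_nonneg (hnn j i) (hp.1 i)
  have hs : ∀ j, 0 ≤ ∑ i, h j i * pstar i := fun j =>
    Finset.sum_nonneg fun i _ => mul_nonneg (hnn j i) (hpstar.1 i)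
  have hpos : ∀ i, 0 < p i → 0 < pstar i := fun i hi =>
    (hpstar.1 i).lt_of_ne fun h0 => hi.ne' (hzero i h0.symm)
  have houtpos : ∀ q : Fin m → ℝ, (∀ i, 0 ≤ q i) → ∀ j i, 0 < h j i → 0 < q i →
      0 < ∑ i', h j i' * q i' := fun q hq j i hh hi =>
    Finset.sum_pos' (fun i' _ => mul_nonneg (hnn j i') (hq i')) ⟨i, Finset.mem_univ i, mul_pos hh hi⟩
  have hcap : C = ∑ i, p i * ∑ j, h j i * Real.log (h j i / ∑ i', h j i' * pstar i') := by
    rw [← one_mul C, ← hp.2, Finset.sum_mul]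
    refine Finset.sum_congr rfl fun i _ => ?_
    rcases (hp.1 i).eq_or_lt with hi | hi
    · simp [← hi]
    · rw [hC i (hpos i hi)]
  have hKL : KL p pstar = ∑ i, ∑ j, p i * h j i * Real.log (p i / pstar i) := by
    refine Finset.sum_congr rfl fun i _ => ?_
    rw [← Finset.sum_mul, ← Finset.mul_sum, hcol, mul_one]
  have hterm : ∑ i, ∑ j, (p i * h j i -
        h j i * pstar i * ((∑ i', h j i' * p i') / ∑ i', h j i' * pstar i')) ≤
      ∑ i, ∑ j, p i * h j i * (Real.log (h j i / ∑ i', h j i' * p i') -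
        Real.log (h j i / ∑ i', h j i' * pstar i') + Real.log (p i / pstar i)) :=
    Finset.sum_le_sum fun i _ => Finset.sum_le_sum fun j _ =>
      mul_log_ratio_ge (hp.1 i) (hpstar.1 i) (hnn j i) (hr j) (hs j) fun hi hh =>
        ⟨hpos i hi, houtpos p hp.1 j i hh hi, houtpos pstar hpstar.1 j i hh (hpos i hi)⟩
  have hlower : 0 ≤ ∑ i, ∑ j, (p i * h j i -
      h j i * pstar i * ((∑ i', h j i' * p i') / ∑ i', h j i' * pstar i')) := by
    have hle := sum_mul_div_le_sum (x := fun j => ∑ i, h j i * pstar i) hr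
    rw [hout, hp.2] at hle
    simp only [Finset.sum_sub_distrib, ← Finset.mul_sum, hcol, mul_one, hp.2]
    rw [Finset.sum_comm]
    simp only [← Finset.sum_mul]
    linarith
  have hsplit : ∑ i, ∑ j, p i * h j i * (Real.log (h j i / ∑ i', h j i' * p i') -
        Real.log (h j i / ∑ i', h j i' * pstar i') + Real.log (p i / pstar i)) =
      ∑ i, p i * ∑ j, h j i * Real.log (h j i / ∑ i', h j i' * p i') - C + KL p pstar := by
    rw [hKL, hcap]
    simp only [Finset.mul_sum, ← Finset.sum_sub_distrib, ← Finset.sum_add_distrib]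
    exact Finset.sum_congr rfl fun i _ => Finset.sum_congr rfl fun j _ => by ring
  linarith
end

section
/- Let (h_{ji}) be an n × m matrix with nonnegative entries whose columns each sum to 1, and let p and p* be PMFs on m symbols with p_i = 0 whenever p*_i = 0. Let r_j = Σ_i h_{ji} p_i and r*_j = Σ_i h_{ji} p*_i. Then D(r‖r*) ≤ D(p‖p*) (data processing inequality for the Kullback-Leibler distance under a stochastic map). -/
/-- The tangent-line bound for `a ↦ a * log (a / b)` in the direction of slope `log c`. -/
theorem mul_log_div_ge {a b c : ℝ} (ha : 0 ≤ a) (hb : 0 ≤ b) (hc : 0 < c) (hab : b = 0 → a = 0) :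
    a * Real.log c + a - b * c ≤ a * Real.log (a / b) := by
  rcases ha.eq_or_lt with rfl | ha
  · simpa using mul_nonneg hb hc.le
  have hb : 0 < b := hb.lt_of_ne fun h => ha.ne' (hab h.symm)
  have hlog := Real.log_le_sub_one_of_pos (div_pos hc (div_pos ha hb))
  rw [Real.log_div hc.ne' (div_pos ha hb).ne'] at hlog
  have hmul := mul_le_mul_of_nonneg_left hlog ha.le
  have heq : a * (c / (a / b) - 1) = b * c - a := by field_simp
  linarith

/-- The log sum inequality. -/
theorem sum_mul_log_sum_div_sum_le {α : Type*} (s : Finset α) {a b : α → ℝ}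
    (ha : ∀ i ∈ s, 0 ≤ a i) (hb : ∀ i ∈ s, 0 ≤ b i) (hab : ∀ i ∈ s, b i = 0 → a i = 0) :
    (∑ i ∈ s, a i) * Real.log ((∑ i ∈ s, a i) / ∑ i ∈ s, b i) ≤
      ∑ i ∈ s, a i * Real.log (a i / b i) := by
  rcases (Finset.sum_nonneg ha).eq_or_lt with hA | hA
  · have hzero := (Finset.sum_eq_zero_iff_of_nonneg ha).1 hA.symm
    rw [← hA, zero_mul, Finset.sum_eq_zero fun i hi => by rw [hzero i hi, zero_mul]]
  have hB : 0 < ∑ i ∈ s, b i := by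
    refine (Finset.sum_nonneg hb).lt_of_ne fun h => hA.ne' ?_
    exact Finset.sum_eq_zero fun i hi =>
      hab i hi ((Finset.sum_eq_zero_iff_of_nonneg hb).1 h.symm i hi)
  have hsum := Finset.sum_le_sum fun i hi =>
    mul_log_div_ge (ha i hi) (hb i hi) (div_pos hA hB) (hab i hi)
  rw [Finset.sum_sub_distrib, Finset.sum_add_distrib, ← Finset.sum_mul, ← Finset.sum_mul,
    mul_div_cancel₀ _ hB.ne'] at hsum
  linarith


/-- Data processing inequality: for a stochastic matrix `(h j i)` (nonnegative
entries, columns summing to 1) and PMFs `p`, `p*` with `p_i = 0` whenever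
`p*_i = 0`, the output PMFs `r`, `r*` satisfy `D(r‖r*) ≤ D(p‖p*)`. -/
theorem KL_data_processing (m n : ℕ) (h : Fin n → Fin m → ℝ)
    (hnn : ∀ j i, 0 ≤ h j i) (hcol : ∀ i, ∑ j, h j i = 1)
    (p pstar : Fin m → ℝ) (hp : IsPMF p) (hps : IsPMF pstar)
    (hzero : ∀ i, pstar i = 0 → p i = 0) :
    KL (fun j => ∑ i, h j i * p i) (fun j => ∑ i, h j i * pstar i) ≤
      KL p pstar := by
  unfold KL
  calc
    _ ≤ ∑ j, ∑ i, h j i * p i * Real.log (h j i * p i / (h j i * pstar i)) := by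
      refine Finset.sum_le_sum fun j _ => sum_mul_log_sum_div_sum_le _
        (fun i _ => mul_nonneg (hnn j i) (hp.1 i)) (fun i _ => mul_nonneg (hnn j i) (hps.1 i))
        fun i _ h0 => ?_
      rcases mul_eq_zero.1 h0 with h0 | h0
      · rw [h0, zero_mul]
      · rw [hzero i h0, mul_zero]
    _ = ∑ j, ∑ i, h j i * (p i * Real.log (p i / pstar i)) := by
      refine Finset.sum_congr rfl fun j _ => Finset.sum_congr rfl fun i _ => ?_
      by_cases h0 : h j i = 0
      · simp [h0]
      · rw [mul_div_mul_left _ _ h0, mul_assoc]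
    _ = ∑ i, p i * Real.log (p i / pstar i) := by
      rw [Finset.sum_comm]
      refine Finset.sum_congr rfl fun i _ => ?_
      rw [← Finset.sum_mul, hcol, one_mul]
end

section
/- Let (h_{ji}) be a discrete memoryless channel, let p* be an input PMF with strictly positive entries and output PMF r*, and let C be a real number such that Σ_j h_{ji}·log(h_{ji}/r*_j) = C for every i. For each k ≥ 1 consider the k-fold product channel with inputs (i_1,…,i_k), outputs (j_1,…,j_k), transition probabilities Π_{t=1}^{k} h_{j_t i_t}, and capacity achieving joint PMF p^{(k)*}(i_1,…,i_k) = Π_t p*_{i_t}. Then for every k there exists a dyadic joint PMF p^{(k)} on the m^k input blocks whose mutual information over the product channel satisfies I(p^{(k)})/k ≥ C − (log 2)/k; hence I(p^{(k)})/k → C as k → ∞. -/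
/-- Mutual information of an input PMF `p` over the `k`-fold product of the DMC
`(h j i)`: `I(p) = Σ_I p_I Σ_J h^k_{JI} log(h^k_{JI}/r_J)` where
`h^k_{JI} = Π_t h_{J_t I_t}` and `r_J = Σ_I h^k_{JI} p_I`. -/
noncomputable def blockMI {m n : ℕ} (h : Fin n → Fin m → ℝ) (k : ℕ)
    (p : (Fin k → Fin m) → ℝ) : ℝ :=
  ∑ I : Fin k → Fin m, p I * ∑ J : Fin k → Fin n,
    (∏ t, h (J t) (I t)) *
      Real.log ((∏ t, h (J t) (I t)) /
        ∑ I' : Fin k → Fin m, (∏ t, h (J t) (I' t)) * p I')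

/-- A finite family of powers of `1/2` with total at least `1` has a subfamily with total `1`. -/
theorem exists_finset_sum_half_pow_eq_one {α : Type*} (s : Finset α) (l : α → ℕ)
    (hs : 1 ≤ ∑ i ∈ s, (1 / 2 : ℝ) ^ l i) :
    ∃ t ⊆ s, ∑ i ∈ t, (1 / 2 : ℝ) ^ l i = 1 := by
  classical
  obtain ⟨t, hts, hmin⟩ := exists_minimal_le_of_wellFoundedLT
    (fun t : Finset α => 1 ≤ ∑ i ∈ t, (1 / 2 : ℝ) ^ l i) s hs
  refine ⟨t, hts, ?_⟩
  have ht : 1 ≤ ∑ i ∈ t, (1 / 2 : ℝ) ^ l i := hmin.prop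
  have hne : t.Nonempty := by
    by_contra hne
    rw [Finset.not_nonempty_iff_eq_empty] at hne
    norm_num [hne] at ht
  obtain ⟨a, ha, hmax⟩ := t.exists_max_image l hne
  have hlt : ∑ i ∈ t.erase a, (1 / 2 : ℝ) ^ l i < 1 :=
    not_le.mp (hmin.not_prop_of_lt (Finset.erase_ssubset ha))
  have hscale : ∀ u ⊆ t, ((∑ i ∈ u, 2 ^ (l a - l i) : ℕ) : ℝ)
      = 2 ^ l a * ∑ i ∈ u, (1 / 2 : ℝ) ^ l i := by
    intro u hu
    rw [Finset.mul_sum]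
    push_cast
    refine Finset.sum_congr rfl fun i hi => ?_
    rw [pow_sub₀ _ two_ne_zero (hmax i (hu hi)), one_div, inv_pow]
  have hpos : (0 : ℝ) < 2 ^ l a := by positivity
  have hge : 2 ^ l a ≤ ∑ i ∈ t, 2 ^ (l a - l i) := by
    have : (2 : ℝ) ^ l a ≤ ((∑ i ∈ t, 2 ^ (l a - l i) : ℕ) : ℝ) := by
      rw [hscale t subset_rfl]
      nlinarith
    exact_mod_cast this
  have hle : ∑ i ∈ t.erase a, 2 ^ (l a - l i) < 2 ^ l a := by
    have : ((∑ i ∈ t.erase a, 2 ^ (l a - l i) : ℕ) : ℝ) < (2 : ℝ) ^ l a := by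
      rw [hscale _ (t.erase_subset a)]
      nlinarith
    exact_mod_cast this
  have hsum := Finset.add_sum_erase t (fun i => 2 ^ (l a - l i)) ha
  simp only [Nat.sub_self, pow_zero] at hsum
  have heq : ∑ i ∈ t, 2 ^ (l a - l i) = 2 ^ l a := by omega
  have := hscale t subset_rfl
  rw [heq] at this
  push_cast at this
  exact mul_left_cancel₀ hpos.ne' (by linarith)

/-- Every positive PMF dominates half of some dyadic PMF. -/
theorem exists_dyadic_le_two_mul {α : Type*} [Fintype α] (q : α → ℝ) (hq : IsPMF q)
    (hpos : ∀ i, 0 < q i) : ∃ p : α → ℝ, IsPMF p ∧ IsDyadic p ∧ ∀ i, p i ≤ 2 * q i := by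
  classical
  have hq1 : ∀ i, q i ≤ 1 := fun i =>
    hq.2 ▸ Finset.single_le_sum (fun j _ => hq.1 j) (Finset.mem_univ i)
  choose l hlt hle using fun i => exists_nat_pow_near_of_lt_one (hpos i) (hq1 i)
    (by norm_num : (0 : ℝ) < 1 / 2) (by norm_num)
  obtain ⟨t, -, ht⟩ := exists_finset_sum_half_pow_eq_one Finset.univ l
    (hq.2.symm.le.trans (Finset.sum_le_sum fun i _ => hle i))
  refine ⟨fun i => if i ∈ t then (1 / 2 : ℝ) ^ l i else 0, ⟨fun i => ?_, ?_⟩, fun i => ?_,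
    fun i => ?_⟩
  · dsimp only
    split_ifs <;> positivity
  · rw [Finset.sum_ite_mem, Finset.univ_inter, ht]
  · by_cases hi : i ∈ t
    · right
      exact ⟨l i, by simp [hi]⟩
    · left
      simp [hi]
  · have := hlt i
    have := hpos i
    rw [pow_succ] at *
    dsimp only
    split_ifs <;> linarith

/-- If every input letter has divergence `D` from the output of `q`, then an input PMF `p ≤ 2q`
has mutual information between `D - log 2` and `D`. -/
theorem mutualInfo_bounds {α β : Type*} [Fintype α] [Fintype β] (W : β → α → ℝ)
    (hW : ∀ j i, 0 ≤ W j i) (hcol : ∀ i, ∑ j, W j i = 1) (p q : α → ℝ) (hp : IsPMF p)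
    (hq : IsPMF q) (hpq : ∀ i, p i ≤ 2 * q i) (D : ℝ)
    (hD : ∀ i, ∑ j, W j i * Real.log (W j i / ∑ i', W j i' * q i') = D) :
    D - Real.log 2 ≤ ∑ i, p i * ∑ j, W j i * Real.log (W j i / ∑ i', W j i' * p i') ∧
    ∑ i, p i * ∑ j, W j i * Real.log (W j i / ∑ i', W j i' * p i') ≤ D := by
  set r : β → ℝ := fun j => ∑ i, W j i * p i with hr
  set s : β → ℝ := fun j => ∑ i, W j i * q i with hs
  have hr0 : ∀ j, 0 ≤ r j := fun j => Finset.sum_nonneg fun i _ => mul_nonneg (hW j i) (hp.1 i)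
  have hs0 : ∀ j, 0 ≤ s j := fun j => Finset.sum_nonneg fun i _ => mul_nonneg (hW j i) (hq.1 i)
  have hrs : ∀ j, r j ≤ 2 * s j := fun j => by
    simp only [hr, hs, Finset.mul_sum]
    exact Finset.sum_le_sum fun i _ => by nlinarith [hW j i, hpq i]
  have htotal : ∀ u : α → ℝ, IsPMF u → ∑ j, ∑ i, W j i * u i = 1 := fun u hu => by
    rw [Finset.sum_comm]
    simp only [← Finset.sum_mul, hcol, one_mul, hu.2]
  have hdiff : (∑ i, p i * ∑ j, W j i * Real.log (W j i / r j)) - D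
      = ∑ j, ∑ i, W j i * p i * Real.log (s j / r j) := by
    have hDp : D = ∑ i, p i * ∑ j, W j i * Real.log (W j i / s j) := by
      simp only [hs, hD, ← Finset.sum_mul, hp.2, one_mul]
    conv_rhs => rw [Finset.sum_comm]
    conv_lhs => rw [hDp]
    rw [← Finset.sum_sub_distrib]
    refine Finset.sum_congr rfl fun i _ => ?_
    rw [← mul_sub, ← Finset.sum_sub_distrib, Finset.mul_sum]
    refine Finset.sum_congr rfl fun j _ => ?_
    rcases (mul_nonneg (hW j i) (hp.1 i)).eq_or_lt with h0 | h0
    · rcases mul_eq_zero.mp h0.symm with h | h <;> simp [h]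
    · have hWp : W j i ≠ 0 := left_ne_zero_of_mul h0.ne'
      have hrp : 0 < r j := h0.trans_le
        (Finset.single_le_sum (f := fun i => W j i * p i)
          (fun i _ => mul_nonneg (hW j i) (hp.1 i)) (Finset.mem_univ i))
      have hsp : 0 < s j := by linarith [hrs j]
      rw [Real.log_div hWp hrp.ne', Real.log_div hWp hsp.ne', Real.log_div hsp.ne' hrp.ne']
      ring
  have hsum : ∀ j, ∑ i, W j i * p i * Real.log (s j / r j) = r j * Real.log (s j / r j) :=
    fun j => by rw [← Finset.sum_mul]
  simp only [hsum] at hdiff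
  have hlow : -Real.log 2 ≤ ∑ j, r j * Real.log (s j / r j) := by
    calc -Real.log 2 = ∑ j, r j * -Real.log 2 := by
          rw [← Finset.sum_mul, htotal p hp, one_mul]
      _ ≤ _ := Finset.sum_le_sum fun j _ => by
          rcases (hr0 j).eq_or_lt with h0 | h0
          · simp [← h0]
          · refine mul_le_mul_of_nonneg_left ?_ h0.le
            rw [← Real.log_inv]
            refine Real.log_le_log (by norm_num) ?_
            rw [le_div_iff₀ h0]
            linarith [hrs j]
  have hupp : ∑ j, r j * Real.log (s j / r j) ≤ 0 := by
    calc _ ≤ ∑ j, (s j - r j) := Finset.sum_le_sum fun j _ => by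
          rcases (hr0 j).eq_or_lt with h0 | h0
          · simpa [← h0] using hs0 j
          · have hsp : 0 < s j := by linarith [hrs j]
            calc r j * Real.log (s j / r j) ≤ r j * (s j / r j - 1) :=
                  mul_le_mul_of_nonneg_left (Real.log_le_sub_one_of_pos (by positivity)) h0.le
              _ = s j - r j := by field_simp
      _ = 0 := by rw [Finset.sum_sub_distrib, htotal p hp, htotal q hq, sub_self]
  constructor <;> linarith

/-- The product of a PMF with itself is a PMF. -/
theorem IsPMF.pi_prod {α : Type*} [Fintype α] {q : α → ℝ} (hq : IsPMF q)
    (k : ℕ) : IsPMF (fun I : Fin k → α => ∏ t, q (I t)) := by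
  classical
  refine ⟨fun I => Finset.prod_nonneg fun t _ => hq.1 _, ?_⟩
  rw [← Fintype.prod_sum (fun _ : Fin k => q)]
  simp [hq.2]

/-- The divergence of a product output distribution is additive over the coordinates. -/
theorem sum_prod_mul_log_div_prod {β : Type*} [Fintype β] {k : ℕ} (w : Fin k → β → ℝ)
    (s : β → ℝ) (hcol : ∀ t, ∑ j, w t j = 1) (hs : ∀ t j, w t j ≠ 0 → s j ≠ 0) (C : ℝ)
    (hC : ∀ t, ∑ j, w t j * Real.log (w t j / s j) = C) :
    ∑ J : Fin k → β, (∏ t, w t (J t)) * Real.log ((∏ t, w t (J t)) / ∏ t, s (J t)) = k * C := by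
  classical
  have hterm : ∀ J : Fin k → β,
      (∏ t, w t (J t)) * Real.log ((∏ t, w t (J t)) / ∏ t, s (J t))
        = ∑ u, ∏ t, (w t (J t) * if t = u then Real.log (w t (J t) / s (J t)) else 1) := by
    intro J
    simp only [Finset.prod_mul_distrib, Finset.prod_ite_eq', Finset.mem_univ, if_true,
      ← Finset.mul_sum]
    by_cases h0 : ∏ t, w t (J t) = 0
    · simp [h0]
    · have hw := fun t => Finset.prod_ne_zero_iff.mp h0 t (Finset.mem_univ t)
      rw [← Finset.prod_div_distrib, Real.log_prod fun t _ => div_ne_zero (hw t) (hs t _ (hw t))]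
  simp only [hterm]
  rw [Finset.sum_comm]
  have hu : ∀ u : Fin k, ∑ J : Fin k → β,
      ∏ t, (w t (J t) * if t = u then Real.log (w t (J t) / s (J t)) else 1) = C := by
    intro u
    rw [← Fintype.prod_sum
      (fun t j => w t j * if t = u then Real.log (w t j / s j) else 1)]
    have : ∀ t, (∑ j, w t j * if t = u then Real.log (w t j / s j) else 1)
        = if t = u then C else 1 := by
      intro t
      split_ifs <;> simp [hC, hcol]
    simp only [this, Finset.prod_ite_eq', Finset.mem_univ, if_true]
  simp only [hu, Finset.sum_const, Finset.card_univ, Fintype.card_fin, nsmul_eq_mul]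

/-- For a DMC with strictly positive capacity achieving PMF `p*` and capacity `C`,
for every block length `k ≥ 1` there is a dyadic joint input PMF on the `k`-fold
product channel achieving mutual information per channel use at least
`C − (log 2)/k`; hence the rate tends to `C` as `k → ∞`. -/
theorem dyadic_block_pmf_achieves_capacity (m n : ℕ) (h : Fin n → Fin m → ℝ)
    (hnn : ∀ j i, 0 ≤ h j i) (hcol : ∀ i, ∑ j, h j i = 1)
    (pstar : Fin m → ℝ) (hpstar : IsPMF pstar) (hpos : ∀ i, 0 < pstar i)
    (C : ℝ)
    (hC : ∀ i, ∑ j, h j i * Real.log (h j i / ∑ i', h j i' * pstar i') = C) :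
    ∃ P : (k : ℕ) → ((Fin k → Fin m) → ℝ),
      (∀ k : ℕ, 0 < k → IsPMF (P k) ∧ IsDyadic (P k) ∧
        blockMI h k (P k) / k ≥ C - Real.log 2 / k) ∧
      Filter.Tendsto (fun k : ℕ => blockMI h k (P k) / k)
        Filter.atTop (nhds C) := by
  classical
  set s : Fin n → ℝ := fun j => ∑ i, h j i * pstar i with hs
  have hs_ne : ∀ i j, h j i ≠ 0 → s j ≠ 0 := fun i j hji =>
    (Finset.sum_pos' (fun i _ => mul_nonneg (hnn j i) (hpos i).le)
      ⟨i, Finset.mem_univ i, mul_pos ((hnn j i).lt_of_ne' hji) (hpos i)⟩).ne'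
  have hout : ∀ (k : ℕ) (J : Fin k → Fin n),
      ∑ I : Fin k → Fin m, (∏ t, h (J t) (I t)) * ∏ t, pstar (I t) = ∏ t, s (J t) := by
    intro k J
    simp only [hs, ← Finset.prod_mul_distrib]
    exact (Fintype.prod_sum fun t i => h (J t) i * pstar i).symm
  choose P hP hdy hle using fun k : ℕ =>
    exists_dyadic_le_two_mul _ (hpstar.pi_prod k) fun I => Finset.prod_pos fun t _ => hpos (I t)
  have hbounds : ∀ k : ℕ,
      k * C - Real.log 2 ≤ blockMI h k (P k) ∧ blockMI h k (P k) ≤ k * C := fun k =>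
    mutualInfo_bounds (fun (J : Fin k → Fin n) (I : Fin k → Fin m) => ∏ t, h (J t) (I t))
      (fun J I => Finset.prod_nonneg fun t _ => hnn _ _)
      (fun I => by
        rw [← Fintype.prod_sum fun t j => h j (I t)]
        simp [hcol])
      (P k) _ (hP k) (hpstar.pi_prod k) (hle k) (k * C)
      (fun I => by
        simp only [hout]
        exact sum_prod_mul_log_div_prod (fun t j => h j (I t)) s (fun t => hcol _)
          (fun t j => hs_ne _ j) C fun t => hC _)
  have hlower : ∀ k : ℕ, 0 < k → C - Real.log 2 / k ≤ blockMI h k (P k) / k := by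
    intro k hk
    have hk' : (0 : ℝ) < k := Nat.cast_pos.mpr hk
    rw [le_div_iff₀ hk', sub_mul, div_mul_cancel₀ _ hk'.ne']
    linarith [(hbounds k).1]
  refine ⟨P, fun k hk => ⟨hP k, hdy k, hlower k hk⟩, ?_⟩
  refine tendsto_of_tendsto_of_tendsto_of_le_of_le' (g := fun k : ℕ => C - Real.log 2 / k)
    (h := fun _ => C) ?_ tendsto_const_nhds ?_ ?_
  · simpa using tendsto_const_nhds.sub (tendsto_const_div_atTop_nhds_zero_nat (Real.log 2))
  · filter_upwards [Filter.eventually_gt_atTop 0] with k hk using hlower k hk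
  · filter_upwards [Filter.eventually_gt_atTop 0] with k hk
    have hk' : (0 : ℝ) < k := Nat.cast_pos.mpr hk
    rw [div_le_iff₀ hk']
    linarith [(hbounds k).2]
end

section
/- Let m ≥ 2, let w_1, …, w_m > 0, and let C > 0 satisfy Σ_i exp(−C·w_i) = 1. Then for every PMF p on m symbols, the entropy satisfies H(p) ≤ C·Σ_i p_i w_i, i.e., the information rate H(p)/(Σ_i p_i w_i) is at most C; equality holds if and only if p_i = exp(−C·w_i) for all i. -/
open InformationTheory in
/-- The Kullback-Leibler integrand of `x` relative to the reference weight `exp (-a)`. -/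
lemma exp_neg_mul_klFun {x : ℝ} (hx : 0 ≤ x) (a : ℝ) :
    Real.exp (-a) * klFun (x * Real.exp a) =
      x * Real.log x + a * x + Real.exp (-a) - x := by
  have hexp : Real.exp (-a) * Real.exp a = 1 := by rw [← Real.exp_add]; simp
  rcases hx.eq_or_lt with rfl | hx
  · simp [klFun_apply]
  · rw [klFun_apply, Real.log_mul hx.ne' (Real.exp_ne_zero a), Real.log_exp]
    linear_combination (x * (Real.log x + a) - x) * hexp

/-- For a memoryless discrete noiseless channel with weights `w_i > 0` and
capacity `C > 0` (so `Σ_i exp(−C·w_i) = 1`), every PMF `p` satisfies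
`H(p) ≤ C·Σ_i p_i w_i`, with equality iff `p_i = exp(−C·w_i)` for all `i`. -/
theorem dnc_entropy_le_capacity_mul_weight (m : ℕ) (hm : 2 ≤ m)
    (w : Fin m → ℝ) (hw : ∀ i, 0 < w i)
    (C : ℝ) (hC : 0 < C) (hCs : ∑ i, Real.exp (-(C * w i)) = 1)
    (p : Fin m → ℝ) (hp : IsPMF p) :
    (-∑ i, p i * Real.log (p i)) ≤ C * ∑ i, p i * w i ∧
      ((-∑ i, p i * Real.log (p i)) = C * ∑ i, p i * w i ↔
        ∀ i, p i = Real.exp (-(C * w i))) := by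
  obtain ⟨hp0, hp1⟩ := hp
  have hterm_nonneg : ∀ i ∈ Finset.univ, 0 ≤ Real.exp (-(C * w i)) *
      InformationTheory.klFun (p i * Real.exp (C * w i)) := fun i _ =>
    mul_nonneg (Real.exp_pos _).le
      (InformationTheory.klFun_nonneg (mul_nonneg (hp0 i) (Real.exp_pos _).le))
  have hsum : ∑ i, Real.exp (-(C * w i)) *
      InformationTheory.klFun (p i * Real.exp (C * w i)) =
      C * ∑ i, p i * w i - (-∑ i, p i * Real.log (p i)) := by
    simp only [exp_neg_mul_klFun (hp0 _), Finset.sum_sub_distrib, Finset.sum_add_distrib, hCs,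
      hp1, Finset.mul_sum, mul_assoc, mul_comm (p _) (w _)]
    ring
  refine ⟨sub_nonneg.mp (hsum ▸ Finset.sum_nonneg hterm_nonneg), ?_⟩
  rw [eq_comm, ← sub_eq_zero, ← hsum, Finset.sum_eq_zero_iff_of_nonneg hterm_nonneg]
  refine forall_congr' fun i => ?_
  simp only [Finset.mem_univ, true_imp_iff, mul_eq_zero, Real.exp_ne_zero, false_or]
  rw [InformationTheory.klFun_eq_zero_iff (mul_nonneg (hp0 i) (Real.exp_pos _).le), Real.exp_neg,
    mul_eq_one_iff_eq_inv₀ (Real.exp_ne_zero _)]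
end

section
/- Let w_1, …, w_m > 0 and C > 0 with Σ_i exp(−C·w_i) = 1, and set p*_i = exp(−C·w_i). Suppose p̃ is a dyadic PMF that maximizes the information rate H̄(p) = H(p)/(Σ_i p_i w_i) over all dyadic PMFs on m symbols, and set R = H̄(p̃)/C. Then for every dyadic PMF p, D(p‖p*^R) = Σ_i p_i·log(p_i/(p*_i)^R) ≥ 0, and D(p̃‖p*^R) = 0; hence a dyadic PMF maximizes H̄ if and only if it minimizes D(·‖p*^R) over dyadic PMFs. -/
/-- Information rate of a PMF `p` over a DNC with weights `w`:
`H̄(p) = H(p)/(Σ_i p_i w_i)`. -/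
noncomputable def Hbar {m : ℕ} (w p : Fin m → ℝ) : ℝ :=
  (-∑ i, p i * Real.log (p i)) / ∑ i, p i * w i

/-- The mean weight of a PMF is positive when all weights are positive. -/
theorem IsPMF.sum_mul_pos {α : Type*} [Fintype α] {p w : α → ℝ} (hp : IsPMF p)
    (hw : ∀ i, 0 < w i) : 0 < ∑ i, p i * w i := by
  have h : 0 < ∑ i, p i := by rw [hp.2]; exact one_pos
  obtain ⟨i, hi, hpi⟩ := Finset.exists_lt_of_sum_lt (s := Finset.univ) (f := fun _ : α => (0 : ℝ))
    (g := p) (by simpa using h)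
  exact Finset.sum_pos' (fun j _ => mul_nonneg (hp.1 j) (hw j).le)
    ⟨i, hi, mul_pos hpi (hw i)⟩

/-- The Kullback-Leibler distance to `exp(-C w)^R` is the mean weight times the rate gap. -/
theorem KL_exp_rpow_eq {m : ℕ} {w p : Fin m → ℝ} (hp : IsPMF p) (hw : ∀ i, 0 < w i) (C R : ℝ) :
    KL p (fun i => Real.exp (-(C * w i)) ^ R) = (∑ i, p i * w i) * (R * C - Hbar w p) := by
  have hS := (hp.sum_mul_pos hw).ne'
  have hterm : ∀ i, p i * Real.log (p i / Real.exp (-(C * w i)) ^ R) =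
      p i * Real.log (p i) + R * C * (p i * w i) := by
    intro i
    rcases eq_or_ne (p i) 0 with h | h
    · simp [h]
    · rw [Real.log_div h (Real.rpow_pos_of_pos (Real.exp_pos _) _).ne',
        Real.log_rpow (Real.exp_pos _), Real.log_exp]
      ring
  simp only [KL, hterm, Finset.sum_add_distrib, ← Finset.mul_sum]
  rw [mul_sub, Hbar, mul_div_cancel₀ _ hS]
  ring

/-- For a DNC with weights `w_i > 0`, capacity `C > 0` and capacity achieving PMF
`p*_i = exp(−C·w_i)`: if the dyadic PMF `p̃` maximizes `H̄` over dyadic PMFs and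
`R = H̄(p̃)/C`, then `D(p‖p*^R) ≥ 0` for every dyadic PMF `p`, `D(p̃‖p*^R) = 0`,
and a dyadic PMF maximizes `H̄` iff it minimizes `D(·‖p*^R)` over dyadic PMFs. -/
theorem dnc_dyadic_optimality_via_weighted_KL (m : ℕ)
    (w : Fin m → ℝ) (hw : ∀ i, 0 < w i)
    (C : ℝ) (hC : 0 < C) (hCs : ∑ i, Real.exp (-(C * w i)) = 1)
    (ptil : Fin m → ℝ) (hptil : IsPMF ptil) (hdy : IsDyadic ptil)
    (hmax : ∀ p : Fin m → ℝ, IsPMF p → IsDyadic p → Hbar w p ≤ Hbar w ptil)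
    (R : ℝ) (hR : R = Hbar w ptil / C) :
    (∀ p : Fin m → ℝ, IsPMF p → IsDyadic p →
        0 ≤ KL p (fun i => Real.exp (-(C * w i)) ^ R)) ∧
      KL ptil (fun i => Real.exp (-(C * w i)) ^ R) = 0 ∧
      (∀ p : Fin m → ℝ, IsPMF p → IsDyadic p →
        ((∀ q : Fin m → ℝ, IsPMF q → IsDyadic q → Hbar w q ≤ Hbar w p) ↔
          (∀ q : Fin m → ℝ, IsPMF q → IsDyadic q →
            KL p (fun i => Real.exp (-(C * w i)) ^ R) ≤
              KL q (fun i => Real.exp (-(C * w i)) ^ R)))) := by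
  have hRC : R * C = Hbar w ptil := by rw [hR, div_mul_cancel₀ _ hC.ne']
  have hKL : ∀ p : Fin m → ℝ, IsPMF p → KL p (fun i => Real.exp (-(C * w i)) ^ R) =
      (∑ i, p i * w i) * (Hbar w ptil - Hbar w p) := fun p hp => by
    rw [KL_exp_rpow_eq hp hw, hRC]
  have hnonneg : ∀ p : Fin m → ℝ, IsPMF p → IsDyadic p →
      0 ≤ KL p (fun i => Real.exp (-(C * w i)) ^ R) := fun p hp hpd => by
    rw [hKL p hp]
    exact mul_nonneg (hp.sum_mul_pos hw).le (sub_nonneg.2 (hmax p hp hpd))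
  have hzero : KL ptil (fun i => Real.exp (-(C * w i)) ^ R) = 0 := by
    rw [hKL ptil hptil, sub_self, mul_zero]
  refine ⟨hnonneg, hzero, fun p hp hpd => ⟨fun h q hq hqd => ?_, fun h q hq hqd => ?_⟩⟩
  · have heq : Hbar w p = Hbar w ptil := le_antisymm (hmax p hp hpd) (h ptil hptil hdy)
    rw [hKL p hp, heq, sub_self, mul_zero]
    exact hnonneg q hq hqd
  · have hle := h ptil hptil hdy
    rw [hzero, hKL p hp] at hle
    have hgap := nonpos_of_mul_nonpos_right hle (hp.sum_mul_pos hw)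
    exact (hmax q hq hqd).trans (sub_nonpos.1 hgap)
end

section
/- Let w_1, …, w_m > 0 and C > 0 with Σ_i exp(−C·w_i) = 1, let w_min = min_i w_i, and set p*_i = exp(−C·w_i). For k ≥ 1 consider blocks of k symbols with additive weights w^{(k)}(i_1,…,i_k) = w_{i_1} + ⋯ + w_{i_k} and product PMF p^{(k)*}(i_1,…,i_k) = Π_t p*_{i_t}. Then for every PMF p^{(k)} on the m^k blocks, the block information rate satisfies H(p^{(k)})/(Σ_I p^{(k)}_I w^{(k)}_I) ≥ C − D(p^{(k)}‖p^{(k)*})/(k·w_min). -/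
theorem sub_le_mul_log_div {a b : ℝ} (ha : 0 ≤ a) (hb : 0 < b) : a - b ≤ a * Real.log (a / b) := by
  rcases ha.eq_or_lt with rfl | ha
  · simpa using hb.le
  · have h := mul_le_mul_of_nonneg_left (Real.one_sub_inv_le_log_of_pos (div_pos ha hb)) ha.le
    have e : a * (1 - (a / b)⁻¹) = a - b := by field_simp
    rwa [e] at h

/-- Gibbs' inequality. -/
theorem IsPMF.KL_nonneg {α : Type*} [Fintype α] {p x : α → ℝ} (hp : IsPMF p)
    (hx : ∀ i, 0 < x i) (hx1 : ∑ i, x i = 1) : 0 ≤ KL p x := by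
  have h : ∑ i, (p i - x i) ≤ KL p x :=
    Finset.sum_le_sum fun i _ => sub_le_mul_log_div (hp.1 i) (hx i)
  rwa [Finset.sum_sub_distrib, hp.2, hx1, sub_self] at h

theorem KL_exp_neg {α : Type*} [Fintype α] (p v : α → ℝ) (C : ℝ) :
    KL p (fun i => Real.exp (-(C * v i))) =
      C * ∑ i, p i * v i - -∑ i, p i * Real.log (p i) := by
  rw [KL, Finset.mul_sum, sub_neg_eq_add, ← Finset.sum_add_distrib]
  refine Finset.sum_congr rfl fun i _ => ?_
  by_cases h : p i = 0
  · simp [h]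
  · rw [Real.log_div h (Real.exp_ne_zero _), Real.log_exp]
    ring

theorem IsPMF.le_sum_mul {α : Type*} [Fintype α] {p v : α → ℝ} (hp : IsPMF p) {c : ℝ}
    (hv : ∀ i, c ≤ v i) : c ≤ ∑ i, p i * v i := by
  calc c = ∑ i, p i * c := by rw [← Finset.sum_mul, hp.2, one_mul]
    _ ≤ ∑ i, p i * v i :=
      Finset.sum_le_sum fun i _ => mul_le_mul_of_nonneg_left (hv i) (hp.1 i)

/-- The information rate bound for an arbitrary finite alphabet whose weights are at least `c`. -/
theorem IsPMF.sub_KL_div_le_rate {α : Type*} [Fintype α] {p v : α → ℝ} (hp : IsPMF p)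
    {C c : ℝ} (hc : 0 < c) (hv : ∀ i, c ≤ v i) (hCs : ∑ i, Real.exp (-(C * v i)) = 1) :
    C - KL p (fun i => Real.exp (-(C * v i))) / c ≤
      (-∑ i, p i * Real.log (p i)) / ∑ i, p i * v i := by
  have hW := hp.le_sum_mul hv
  have hD := hp.KL_nonneg (fun i => Real.exp_pos (-(C * v i))) hCs
  have hne : ∑ i, p i * v i ≠ 0 := (hc.trans_le hW).ne'
  have hH : (-∑ i, p i * Real.log (p i)) / ∑ i, p i * v i =
      C - KL p (fun i => Real.exp (-(C * v i))) / ∑ i, p i * v i := by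
    rw [KL_exp_neg]
    field_simp
    ring
  rw [hH]
  gcongr

/-- For a DNC with weights `w_i > 0`, capacity `C > 0` (`Σ_i exp(−C·w_i) = 1`),
minimal weight `w_min`, blocks of `k ≥ 1` symbols with additive weights
`w^(k)(I) = Σ_t w_{I_t}` and product capacity achieving PMF
`p^(k)*(I) = Π_t exp(−C·w_{I_t})`: every block PMF `p^(k)` satisfies
`H(p^(k))/(Σ_I p^(k)_I w^(k)_I) ≥ C − D(p^(k)‖p^(k)*)/(k·w_min)`. -/
theorem dnc_block_rate_lower_bound (m : ℕ) (w : Fin m → ℝ) (hw : ∀ i, 0 < w i)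
    (C : ℝ) (hC : 0 < C) (hCs : ∑ i, Real.exp (-(C * w i)) = 1)
    (wmin : ℝ) (hwmin : IsLeast (Set.range w) wmin)
    (k : ℕ) (hk : 0 < k)
    (pk : (Fin k → Fin m) → ℝ) (hpk : IsPMF pk) :
    (-∑ I : Fin k → Fin m, pk I * Real.log (pk I)) /
        (∑ I : Fin k → Fin m, pk I * ∑ t, w (I t)) ≥
      C - KL pk (fun I => ∏ t, Real.exp (-(C * w (I t)))) / (k * wmin) := by
  obtain ⟨⟨i₀, rfl⟩, hmin⟩ := hwmin
  have hprod (I : Fin k → Fin m) :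
      ∏ t, Real.exp (-(C * w (I t))) = Real.exp (-(C * ∑ t, w (I t))) := by
    rw [← Real.exp_sum, Finset.sum_neg_distrib, Finset.mul_sum]
  have hsum : ∑ I : Fin k → Fin m, Real.exp (-(C * ∑ t, w (I t))) = 1 := by
    simp_rw [← hprod]
    rw [← Fintype.sum_pow (fun i => Real.exp (-(C * w i))) k, hCs, one_pow]
  have hle (I : Fin k → Fin m) : k * w i₀ ≤ ∑ t, w (I t) := by
    simpa using Finset.card_nsmul_le_sum Finset.univ (fun t => w (I t)) (w i₀)
      fun t _ => hmin (Set.mem_range_self (I t))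
  simp_rw [hprod]
  exact hpk.sub_KL_div_le_rate (mul_pos (Nat.cast_pos.2 hk) (hw i₀)) hle hsum
end

section
/- Let x be a vector of m strictly positive reals and suppose the dyadic PMF p minimizes D(q‖x) = Σ_i q_i·log(q_i/x_i) over all dyadic PMFs q on m symbols. Then for all indices i, j, if x_i > x_j then p_i ≥ p_j. -/
theorem KL_eq_sum_sub_sum {α : Type*} [Fintype α] (p x : α → ℝ) (hx : ∀ i, 0 < x i) :
    KL p x = ∑ i, p i * Real.log (p i) - ∑ i, p i * Real.log (x i) := by
  rw [KL, ← Finset.sum_sub_distrib]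
  refine Finset.sum_congr rfl fun i _ => ?_
  rcases eq_or_ne (p i) 0 with h | h
  · simp [h]
  · rw [Real.log_div h (hx i).ne', mul_sub]

theorem IsPMF.comp_equiv {α : Type*} [Fintype α] {p : α → ℝ} (hp : IsPMF p)
    (e : Equiv.Perm α) : IsPMF (p ∘ e) :=
  ⟨fun i => hp.1 (e i), (Equiv.sum_comp e p).trans hp.2⟩

theorem KL_comp_swap_sub_KL {α : Type*} [Fintype α] [DecidableEq α] (p x : α → ℝ)
    (hx : ∀ i, 0 < x i) {i j : α} (hij : i ≠ j) :
    KL (p ∘ Equiv.swap i j) x - KL p x =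
      (p i - p j) * (Real.log (x i) - Real.log (x j)) := by
  have hent : ∑ k, (p ∘ Equiv.swap i j) k * Real.log ((p ∘ Equiv.swap i j) k) =
      ∑ k, p k * Real.log (p k) :=
    Equiv.sum_comp (Equiv.swap i j) fun k => p k * Real.log (p k)
  have hlin : ∑ k, (p k * Real.log (x k) - (p ∘ Equiv.swap i j) k * Real.log (x k)) =
      (p i - p j) * (Real.log (x i) - Real.log (x j)) := by
    rw [Fintype.sum_eq_add i j hij]
    · simp only [Function.comp_apply, Equiv.swap_apply_left, Equiv.swap_apply_right]
      ring
    · rintro k ⟨hki, hkj⟩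
      simp [Equiv.swap_apply_of_ne_of_ne hki hkj]
  rw [Finset.sum_sub_distrib] at hlin
  rw [KL_eq_sum_sub_sum _ x hx, KL_eq_sum_sub_sum p x hx, hent]
  linarith

/-- If the dyadic PMF `p` minimizes `D(·‖x)` over dyadic PMFs for a strictly
positive vector `x`, then `x_i > x_j` implies `p_i ≥ p_j`. -/
theorem optimal_dyadic_pmf_monotone (m : ℕ) (x : Fin m → ℝ) (hx : ∀ i, 0 < x i)
    (p : Fin m → ℝ) (hp : IsPMF p) (hdy : IsDyadic p)
    (hopt : ∀ q : Fin m → ℝ, IsPMF q → IsDyadic q → KL p x ≤ KL q x) :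
    ∀ i j, x i > x j → p i ≥ p j := by
  intro i j hij
  have hne : i ≠ j := by
    rintro rfl
    exact lt_irrefl _ hij
  have hle := hopt (p ∘ Equiv.swap i j) (hp.comp_equiv _) fun k => hdy (Equiv.swap i j k)
  have hlog : Real.log (x j) < Real.log (x i) := Real.log_lt_log (hx j) hij
  have hprod : 0 ≤ (p i - p j) * (Real.log (x i) - Real.log (x j)) := by
    rw [← KL_comp_swap_sub_KL p x hx hne]
    exact sub_nonneg.2 hle
  exact sub_nonneg.1 (nonneg_of_mul_nonneg_left hprod (sub_pos.2 hlog))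
end

section
/- Let m ≥ 2 and let x ∈ ℝ^m satisfy x_1 ≥ x_2 ≥ ⋯ ≥ x_m > 0 with x_{m−1} < 4·x_m. Define x' ∈ ℝ^{m−1} by x'_i = x_i for i ≤ m−2 and x'_{m−1} = 2·√(x_{m−1}·x_m). Then the infimum of D(p‖x) = Σ_i p_i·log(p_i/x_i) over all dyadic PMFs p on m symbols equals the infimum of D(q‖x') over all dyadic PMFs q on m−1 symbols. -/
/-- The sorted rearrangement of `p` has the smallest distance to a nonincreasing vector `x`. -/
theorem exists_perm_antitone_KL_le {n : ℕ} (p x : Fin n → ℝ) (hx : ∀ i, 0 < x i)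
    (hmono : Antitone x) :
    ∃ σ : Equiv.Perm (Fin n), Antitone (p ∘ σ) ∧ KL (p ∘ σ) x ≤ KL p x := by
  have key : ∀ r : Fin n → ℝ,
      KL r x = ∑ i, r i * Real.log (r i) - ∑ i, r i * Real.log (x i) := by
    intro r
    rw [KL, ← Finset.sum_sub_distrib]
    refine Finset.sum_congr rfl fun i _ => ?_
    rcases eq_or_ne (r i) 0 with h | h
    · simp [h]
    · rw [Real.log_div h (hx i).ne', mul_sub]
  set σ := Tuple.sort (fun i => -p i)
  have hanti : Antitone (p ∘ σ) := by
    intro i j hij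
    have h := Tuple.monotone_sort (fun i => -p i) hij
    exact neg_le_neg_iff.mp h
  refine ⟨σ, hanti, ?_⟩
  have hlog : Antitone fun i => Real.log (x i) :=
    fun i j hij => Real.log_le_log (hx j) (hmono hij)
  have hre := (hanti.monovary hlog).sum_comp_perm_mul_le_sum_mul (σ := σ.symm)
  simp only [Function.comp_apply, Equiv.apply_symm_apply] at hre
  have hent : ∑ i, (p ∘ σ) i * Real.log ((p ∘ σ) i) = ∑ i, p i * Real.log (p i) :=
    Equiv.sum_comp σ fun i => p i * Real.log (p i)
  rw [key, key, hent]
  simp only [Function.comp_apply]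
  linarith

/-- In a nonincreasing dyadic PMF with full support, the two smallest entries coincide. -/
theorem IsDyadic.last_eq_of_antitone {m : ℕ} {r : Fin (m + 2) → ℝ} (hp : IsPMF r)
    (hd : IsDyadic r) (hr : Antitone r) (hpos : 0 < r (Fin.last (m + 1))) :
    r (Fin.last m).castSucc = r (Fin.last (m + 1)) := by
  by_contra hne
  have hlt : r (Fin.last (m + 1)) < r (Fin.last m).castSucc :=
    lt_of_le_of_ne (hr (Fin.le_last _)) (Ne.symm hne)
  have hex : ∀ i, ∃ ℓ : ℕ, r i = (2 : ℝ) ^ (-(ℓ : ℤ)) := fun i =>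
    (hd i).resolve_left (hpos.trans_le (hr (Fin.le_last i))).ne'
  choose ℓ hℓ using hex
  have hℓlt : ∀ i : Fin (m + 1), ℓ i.castSucc < ℓ (Fin.last (m + 1)) := by
    intro i
    have h : r (Fin.last (m + 1)) < r i.castSucc :=
      hlt.trans_le (hr (Fin.castSucc_le_castSucc_iff.mpr (Fin.le_last i)))
    rw [hℓ, hℓ i.castSucc, zpow_lt_zpow_iff_right₀ (by norm_num)] at h
    omega
  set L := ℓ (Fin.last (m + 1)) with hL
  have heven : ∀ i : Fin (m + 1),
      (2 : ℝ) ^ L * r i.castSucc = ((2 * 2 ^ (L - ℓ i.castSucc - 1) : ℕ) : ℝ) := by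
    intro i
    have h := hℓlt i
    rw [hℓ i.castSucc]
    push_cast
    rw [← pow_succ', ← zpow_natCast, ← zpow_natCast, ← zpow_add₀ (by norm_num)]
    congr 1
    omega
  have hlast : (2 : ℝ) ^ L * r (Fin.last (m + 1)) = 1 := by
    rw [hℓ, ← hL, zpow_neg, zpow_natCast]
    exact mul_inv_cancel₀ (by positivity)
  have hsum : (2 : ℝ) ^ L * ∑ i, r i = 2 ^ L := by rw [hp.2, mul_one]
  rw [Fin.sum_univ_castSucc, mul_add, hlast, Finset.mul_sum,
    Finset.sum_congr rfl fun i _ => heven i] at hsum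
  have hnat : ∑ i : Fin (m + 1), 2 * 2 ^ (L - ℓ i.castSucc - 1) + 1 = 2 ^ L := by
    exact_mod_cast hsum
  rw [← Finset.mul_sum] at hnat
  have hLpos := hℓlt 0
  obtain ⟨K, hK⟩ : ∃ K, L = K + 1 := ⟨L - 1, by omega⟩
  have hpow : 2 ^ L = 2 * 2 ^ K := by rw [hK, pow_succ']
  omega

theorem log_two_mul_sqrt_mul {a b : ℝ} (ha : 0 < a) (hb : 0 < b) :
    Real.log (2 * Real.sqrt (a * b)) = Real.log 2 + (Real.log a + Real.log b) / 2 := by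
  rw [Real.log_mul two_ne_zero (by positivity), Real.log_sqrt (by positivity),
    Real.log_mul ha.ne' hb.ne']

/-- Splitting a mass evenly over `a` and `b` costs the same as placing it on `2√(ab)`. -/
theorem mul_log_div_add_mul_log_div {a b : ℝ} (ha : 0 < a) (hb : 0 < b) (t : ℝ) :
    t * Real.log (t / a) + t * Real.log (t / b)
      = (t + t) * Real.log ((t + t) / (2 * Real.sqrt (a * b))) := by
  rcases eq_or_ne t 0 with rfl | h
  · simp
  · rw [← two_mul t, Real.log_div h ha.ne', Real.log_div h hb.ne',
      Real.log_div (by simpa using h) (by positivity), Real.log_mul two_ne_zero h,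
      log_two_mul_sqrt_mul ha hb]
    ring

/-- For `a < 4b`, placing a mass on `2√(ab)` is cheaper than placing it on `a`. -/
theorem mul_log_div_two_mul_sqrt_le {a b t : ℝ} (ha : 0 < a) (hb : 0 < b) (hab : a < 4 * b)
    (ht : 0 ≤ t) :
    t * Real.log (t / (2 * Real.sqrt (a * b))) ≤ t * Real.log (t / a) := by
  rcases ht.eq_or_lt with rfl | h
  · simp
  · have hs : a ≤ 2 * Real.sqrt (a * b) := by
      have : a / 2 ≤ Real.sqrt (a * b) := Real.le_sqrt_of_sq_le (by nlinarith)
      linarith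
    gcongr

/-- GHC reduction step, combining case. For a nonincreasing strictly positive
vector `x` on `m+2 ≥ 2` symbols with `x_{m} < 4·x_{m+1}` (0-indexed last two
entries), replacing the last two entries by `2·√(x_m·x_{m+1})` preserves the
infimum of `D(·‖x)` over dyadic PMFs. -/
theorem ghc_reduction_combine (m : ℕ) (x : Fin (m + 2) → ℝ)
    (hx : ∀ i, 0 < x i)
    (hmono : ∀ i j : Fin (m + 2), i ≤ j → x j ≤ x i)
    (hcond : x ⟨m, by omega⟩ < 4 * x ⟨m + 1, by omega⟩)
    (x' : Fin (m + 1) → ℝ)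
    (hx' : ∀ i : Fin (m + 1), x' i =
      if (i : ℕ) = m then
        2 * Real.sqrt (x ⟨m, by omega⟩ * x ⟨m + 1, by omega⟩)
      else x (Fin.castSucc i)) :
    sInf {d : ℝ | ∃ p : Fin (m + 2) → ℝ, IsPMF p ∧ IsDyadic p ∧ d = KL p x} =
      sInf {d : ℝ | ∃ q : Fin (m + 1) → ℝ, IsPMF q ∧ IsDyadic q ∧ d = KL q x'} := by
  set a := x (Fin.last m).castSucc with ha_def
  set b := x (Fin.last (m + 1)) with hb_def
  have ha : 0 < a := hx _
  have hb : 0 < b := hx _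
  have hab : a < 4 * b := hcond
  have hxlast : x' (Fin.last m) = 2 * Real.sqrt (a * b) := by
    rw [hx', if_pos (Fin.val_last m)]
    rfl
  have hxinit : ∀ i : Fin m, x' i.castSucc = x i.castSucc.castSucc := by
    intro i
    rw [hx', if_neg (by simpa using i.isLt.ne)]
  apply csInf_eq_csInf_of_forall_exists_le
  · rintro _ ⟨p, hp, hd, rfl⟩
    obtain ⟨σ, hanti, hle⟩ := exists_perm_antitone_KL_le p x hx hmono
    set r := p ∘ σ with hr
    have hrp : IsPMF r := ⟨fun i => hp.1 _, (Equiv.sum_comp σ p).trans hp.2⟩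
    have hrd : IsDyadic r := fun i => hd _
    have hsum := hrp.2
    rw [Fin.sum_univ_castSucc, Fin.sum_univ_castSucc] at hsum
    set s := r (Fin.last m).castSucc with hs
    set t := r (Fin.last (m + 1)) with ht
    have hs0 : 0 ≤ s := hrp.1 _
    have ht0 : 0 ≤ t := hrp.1 _
    have hcases : t = 0 ∨ s = t := by
      rcases ht0.eq_or_lt with h | h
      · exact Or.inl h.symm
      · exact Or.inr (hrd.last_eq_of_antitone hrp hanti h)
    refine ⟨_, ⟨Fin.snoc (α := fun _ => ℝ) (fun i : Fin m => r i.castSucc.castSucc) (s + t),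
      ⟨?_, ?_⟩, ?_, rfl⟩, le_trans ?_ hle⟩
    · intro i
      refine Fin.lastCases ?_ (fun j => ?_) i
      · rw [Fin.snoc_last]
        positivity
      · rw [Fin.snoc_castSucc]
        exact hrp.1 _
    · rw [Fin.sum_univ_castSucc]
      simp only [Fin.snoc_castSucc, Fin.snoc_last]
      linarith
    · intro i
      refine Fin.lastCases ?_ (fun j => ?_) i
      · rw [Fin.snoc_last]
        rcases hcases with h | h
        · rw [h, add_zero]
          exact hrd _
        · rcases hrd (Fin.last (m + 1)) with h0 | ⟨L, hL⟩
          · left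
            rw [h, ht, h0, add_zero]
          · right
            rw [← ht] at hL
            have hnn : 0 ≤ ∑ i : Fin m, r i.castSucc.castSucc :=
              Finset.sum_nonneg fun i _ => hrp.1 _
            cases L with
            | zero =>
              simp at hL
              linarith
            | succ K =>
              refine ⟨K, ?_⟩
              rw [h, hL, ← two_mul, ← zpow_one_add₀ two_ne_zero]
              congr 1
              push_cast
              ring
      · rw [Fin.snoc_castSucc]
        exact hrd _
    · rw [KL, KL, Fin.sum_univ_castSucc, Fin.sum_univ_castSucc (n := m + 1),
        Fin.sum_univ_castSucc (n := m)]
      simp only [Fin.snoc_castSucc, Fin.snoc_last, hxinit, hxlast, ← hs, ← ht, ← ha_def,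
        ← hb_def]
      rw [add_assoc]
      gcongr
      rcases hcases with h | h
      · rw [h]
        simpa using mul_log_div_two_mul_sqrt_le ha hb hab hs0
      · rw [h]
        exact (mul_log_div_add_mul_log_div ha hb t).ge
  · rintro _ ⟨q, hq, hd, rfl⟩
    have hsum := hq.2
    rw [Fin.sum_univ_castSucc] at hsum
    set t := q (Fin.last m) / 2 with ht
    have htt : q (Fin.last m) = t + t := by rw [ht]; ring
    have ht0 : 0 ≤ t := div_nonneg (hq.1 _) zero_le_two
    have htd : t = 0 ∨ ∃ ℓ : ℕ, t = (2 : ℝ) ^ (-(ℓ : ℤ)) := by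
      rcases hd (Fin.last m) with h | ⟨L, hL⟩
      · left
        rw [ht, h, zero_div]
      · right
        refine ⟨L + 1, ?_⟩
        rw [ht, hL, div_eq_mul_inv, ← zpow_sub_one₀ two_ne_zero]
        congr 1
        push_cast
        ring
    refine ⟨_, ⟨Fin.snoc (α := fun _ => ℝ)
      (Fin.snoc (α := fun _ => ℝ) (fun i : Fin m => q i.castSucc) t) t,
      ⟨?_, ?_⟩, ?_, rfl⟩, le_of_eq ?_⟩
    · intro i
      refine Fin.lastCases ?_ (fun j => Fin.lastCases ?_ (fun k => ?_) j) i
      · simpa using ht0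
      · simpa using ht0
      · simpa using hq.1 _
    · rw [Fin.sum_univ_castSucc, Fin.sum_univ_castSucc]
      simp only [Fin.snoc_castSucc, Fin.snoc_last]
      linarith
    · intro i
      refine Fin.lastCases ?_ (fun j => Fin.lastCases ?_ (fun k => ?_) j) i
      · simpa only [Fin.snoc_last] using htd
      · simpa only [Fin.snoc_castSucc, Fin.snoc_last] using htd
      · simpa only [Fin.snoc_castSucc] using hd _
    · rw [KL, KL, Fin.sum_univ_castSucc, Fin.sum_univ_castSucc (n := m),
        Fin.sum_univ_castSucc (n := m)]
      simp only [Fin.snoc_castSucc, Fin.snoc_last, hxinit, hxlast, htt, ← ha_def, ← hb_def]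
      rw [add_assoc, mul_log_div_add_mul_log_div ha hb t]
end
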